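/- arXiv:1203.0945 — 2 statements merged into one kernel-verified Lean document; each statement's English description precedes it below -/
import Mathlib

section
/- Let q ≥ 2 be a prime power. There exists a constant l_0 > 0 (depending only on q) such that for all coprime integers l and m with l_0 < l < m < 2l, and for every real number r > q^{2m^3}, there exist nonnegative integers α and β such that r < (q^m − 1)^α (q^l − 1)^β / (q − 1) < rq. -/
/-- Coprime `l`, `m` with `1 < m` admit a Bézout relation `t * l = s * m + 1` with small
coefficients. -/
theorem Nat.Coprime.exists_mul_eq_mul_add_one {l m : ℕ} (h : Nat.Coprime l m) (hm : 1 < m) :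
    ∃ s t : ℕ, s < l ∧ t < m ∧ t * l = s * m + 1 := by
  obtain ⟨t, htm, ht⟩ := Nat.exists_mul_mod_eq_one_of_coprime h hm
  have hdiv : t * l = l * t / m * m + 1 := by
    have := Nat.div_add_mod (l * t) m
    rw [ht] at this
    linarith
  refine ⟨l * t / m, t, ?_, htm, hdiv⟩
  by_contra! hle
  nlinarith [Nat.mul_le_mul_right m hle, Nat.mul_le_mul_right l htm.le]

/-- If `B ^ t / A ^ s` lies in `[√q, q)` and `A ≤ q ^ m`, then every `R` that is large in terms of
`A` is approximated from above by some `A ^ α * B ^ β` within a factor `q`. -/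
theorem exists_pow_mul_pow_near {q A B R : ℝ} {m s t : ℕ} (hq : 1 < q) (hA : 1 < A) (hB : 0 < B)
    (hAq : A ≤ q ^ m) (hlow : q * (A ^ s) ^ 2 ≤ (B ^ t) ^ 2) (hup : B ^ t < q * A ^ s)
    (hR : A ^ (2 * m * s) ≤ R) :
    ∃ α β : ℕ, R < A ^ α * B ^ β ∧ A ^ α * B ^ β < R * q := by
  have hA0 : 0 < A := by linarith
  have hR1 : 1 ≤ R := (one_le_pow₀ hA.le).trans hR
  obtain ⟨k, hk, hk'⟩ := exists_nat_pow_near hR1 hA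
  have hks : 2 * m * s ≤ k :=
    Nat.lt_succ_iff.mp ((pow_lt_pow_iff_right₀ hA).mp (hR.trans_lt hk'))
  have hAs : 0 < A ^ s := pow_pos hA0 s
  have hAk : 0 < A ^ k := pow_pos hA0 k
  set c := B ^ t / A ^ s with hc
  have hcpos : 0 < c := by positivity
  have hcq : c < q := by rwa [hc, div_lt_iff₀ hAs]
  have hc2 : q ≤ c ^ 2 := by rwa [hc, div_pow, le_div_iff₀ (by positivity)]
  have hc1 : 1 < c := by nlinarith
  obtain ⟨n, hn, hn'⟩ := exists_nat_pow_near ((one_le_div hAk).mpr hk) hc1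
  rw [le_div_iff₀ hAk] at hn
  rw [div_lt_iff₀ hAk] at hn'
  have hnm : n < 2 * m := by
    refine (pow_lt_pow_iff_right₀ hc1).mp ?_
    have h1 : c ^ n < A := by
      refine lt_of_mul_lt_mul_right (hn.trans_lt ?_) hAk.le
      rwa [← pow_succ']
    calc c ^ n < A := h1
      _ ≤ q ^ m := hAq
      _ ≤ (c ^ 2) ^ m := pow_le_pow_left₀ (by linarith) hc2 m
      _ = c ^ (2 * m) := (pow_mul c 2 m).symm
  have hle : s * (n + 1) ≤ k := by nlinarith [Nat.mul_le_mul_left s hnm]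
  have key : A ^ (k - s * (n + 1)) * B ^ (t * (n + 1)) = c ^ (n + 1) * A ^ k := by
    rw [← pow_sub_mul_pow A hle, hc, div_pow, ← pow_mul, ← pow_mul]
    field_simp
  refine ⟨k - s * (n + 1), t * (n + 1), ?_, ?_⟩
  · rwa [key]
  · rw [key]
    calc c ^ (n + 1) * A ^ k = c ^ n * A ^ k * c := by ring
      _ ≤ R * c := by gcongr
      _ < R * q := by gcongr

theorem pow_sub_one_eq_mul {q : ℝ} (hq : 0 < q) (l : ℕ) :
    q ^ l - 1 = q ^ l * (1 - (q ^ l)⁻¹) := by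
  field_simp

theorem pow_sub_one_pow_lt {q : ℝ} (hq : 1 < q) {l m s t : ℕ} (hl : 0 < l) (hlm : l < m)
    (hst : t * l = s * m + 1) :
    (q ^ l - 1) ^ t < q * (q ^ m - 1) ^ s := by
  have hq0 : 0 < q := by linarith
  have hts : s < t := by
    by_contra! h
    nlinarith [Nat.mul_le_mul_right l h, Nat.mul_le_mul_left s hlm.le]
  have hl1 : 1 < q ^ l := one_lt_pow₀ hq hl.ne'
  have hu0 : 0 < 1 - (q ^ l)⁻¹ := sub_pos.mpr (inv_lt_one_of_one_lt₀ hl1)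
  have hu1 : 1 - (q ^ l)⁻¹ < 1 := by
    have : 0 < (q ^ l)⁻¹ := by positivity
    linarith
  have huv : 1 - (q ^ l)⁻¹ ≤ 1 - (q ^ m)⁻¹ := by
    gcongr
    exact hq.le
  rw [pow_sub_one_eq_mul hq0 l, pow_sub_one_eq_mul hq0 m, mul_pow, mul_pow, ← pow_mul, ← pow_mul,
    mul_comm l t, hst, pow_succ, mul_comm s m]
  calc q ^ (m * s) * q * (1 - (q ^ l)⁻¹) ^ t
      < q ^ (m * s) * q * (1 - (q ^ l)⁻¹) ^ s := by
        have := pow_lt_pow_right_of_lt_one₀ hu0 hu1 hts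
        gcongr
    _ ≤ q ^ (m * s) * q * (1 - (q ^ m)⁻¹) ^ s := by gcongr
    _ = q * (q ^ (m * s) * (1 - (q ^ m)⁻¹) ^ s) := by ring

theorem le_pow_sub_one_pow_sq {q : ℝ} (hq : 2 ≤ q) {l m s t : ℕ}
    (htl : 4 * (t : ℝ) ≤ q ^ l) (hst : t * l = s * m + 1) :
    q * ((q ^ m - 1) ^ s) ^ 2 ≤ ((q ^ l - 1) ^ t) ^ 2 := by
  have hq0 : 0 < q := by linarith
  have hl0 : 0 < q ^ l := by positivity
  have hinv : (q ^ l)⁻¹ ≤ 1 := inv_le_one_of_one_le₀ (one_le_pow₀ (by linarith))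
  have bern : 3 / 4 ≤ (1 - (q ^ l)⁻¹) ^ t := by
    have h := one_add_mul_le_pow (a := -(q ^ l)⁻¹) (by linarith) t
    have h4 : (t : ℝ) * (q ^ l)⁻¹ ≤ 1 / 4 := by
      rw [← div_eq_mul_inv, div_le_iff₀ hl0]
      linarith
    rw [← sub_eq_add_neg] at h
    linarith
  have hB : q ^ (m * s) * q * (3 / 4) ≤ (q ^ l - 1) ^ t := by
    rw [pow_sub_one_eq_mul hq0 l, mul_pow, ← pow_mul, mul_comm l t, hst, pow_succ, mul_comm s m]
    gcongr
  have hA : (q ^ m - 1) ^ s ≤ q ^ (m * s) := by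
    rw [pow_mul]
    have : 1 ≤ q ^ m := one_le_pow₀ (by linarith)
    exact pow_le_pow_left₀ (by linarith) (by linarith) s
  have hA0 : 0 ≤ (q ^ m - 1) ^ s :=
    pow_nonneg (sub_nonneg.mpr (one_le_pow₀ (by linarith))) s
  calc q * ((q ^ m - 1) ^ s) ^ 2 ≤ q * (q ^ (m * s)) ^ 2 := by gcongr
    _ ≤ (q ^ (m * s) * q * (3 / 4)) ^ 2 := by
      have : 0 ≤ (q ^ (m * s)) ^ 2 * (q * (q * (9 / 16) - 1)) := by
        have : 0 ≤ q * (9 / 16) - 1 := by linarith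
        positivity
      linarith
    _ ≤ ((q ^ l - 1) ^ t) ^ 2 := by gcongr

theorem eight_mul_le_two_pow {l : ℕ} (hl : 6 ≤ l) : 8 * l ≤ 2 ^ l := by
  induction l, hl using Nat.le_induction with
  | base => norm_num
  | succ n hn ih => rw [pow_succ]; omega


/-- Let `q ≥ 2` be a prime power. There is a constant `l₀ > 0` (depending only on `q`)
such that for all coprime integers `l, m` with `l₀ < l < m < 2l` and every real
`r > q^(2m³)`, there exist nonnegative integers `α, β` with
`r < (q^m − 1)^α (q^l − 1)^β / (q − 1) < rq`. -/
theorem stmt6 (q : ℕ) (hq : IsPrimePow q) (hq2 : 2 ≤ q) :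
    ∃ l₀ : ℕ, 0 < l₀ ∧ ∀ l m : ℕ, Nat.Coprime l m → l₀ < l → l < m → m < 2 * l →
      ∀ r : ℝ, (q : ℝ) ^ (2 * m ^ 3) < r →
        ∃ α β : ℕ,
          r < ((q : ℝ) ^ m - 1) ^ α * ((q : ℝ) ^ l - 1) ^ β / ((q : ℝ) - 1) ∧
          ((q : ℝ) ^ m - 1) ^ α * ((q : ℝ) ^ l - 1) ^ β / ((q : ℝ) - 1) < r * q := by
  have hq2' : (2 : ℝ) ≤ q := by exact_mod_cast hq2
  refine ⟨6, by norm_num, fun l m hcop hl hlm hml r hr => ?_⟩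
  obtain ⟨s, t, hsl, htm, hst⟩ := hcop.exists_mul_eq_mul_add_one (by omega)
  have htl : 4 * (t : ℝ) ≤ (q : ℝ) ^ l := by
    have h : 4 * t ≤ q ^ l := calc
      4 * t ≤ 8 * l := by omega
      _ ≤ 2 ^ l := eight_mul_le_two_pow hl.le
      _ ≤ q ^ l := Nat.pow_le_pow_left hq2 l
    exact_mod_cast h
  have two_lt_pow : ∀ k : ℕ, 1 < k → 2 < (q : ℝ) ^ k := fun k hk =>
    hq2'.trans_lt (lt_self_pow₀ (by linarith) hk)
  have hA := two_lt_pow m (by omega)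
  have hB := two_lt_pow l (by omega)
  have hr0 : 0 < r := lt_trans (by positivity) hr
  have hR : ((q : ℝ) ^ m - 1) ^ (2 * m * s) ≤ r * (q - 1) := calc
    ((q : ℝ) ^ m - 1) ^ (2 * m * s) ≤ ((q : ℝ) ^ m) ^ (2 * m * s) :=
      pow_le_pow_left₀ (by linarith) (by linarith) _
    _ = (q : ℝ) ^ (m * (2 * m * s)) := (pow_mul _ _ _).symm
    _ ≤ (q : ℝ) ^ (2 * m ^ 3) := by
      refine pow_le_pow_right₀ (by linarith) ?_
      calc m * (2 * m * s) ≤ m * (2 * m * m) := by gcongr; omega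
        _ = 2 * m ^ 3 := by ring
    _ ≤ r := hr.le
    _ ≤ r * (q - 1) := le_mul_of_one_le_right hr0.le (by linarith)
  obtain ⟨α, β, h1, h2⟩ := exists_pow_mul_pow_near (by linarith) (by linarith) (by linarith)
    (by linarith) (le_pow_sub_one_pow_sq hq2' htl hst)
    (pow_sub_one_pow_lt (by linarith) (by omega) hlm hst) hR
  have hq1 : (0 : ℝ) < q - 1 := by linarith
  refine ⟨α, β, (lt_div_iff₀ hq1).mpr h1, (div_lt_iff₀ hq1).mpr ?_⟩
  linarith
end

section
/- Let q ≥ 2 be an integer. There exists a constant l_0 > 0 (depending only on q) such that for all integers l and m with l_0 < l < m < 2l, one has log_q(q^l − 1)/log_q(q^m − 1) < l/m and l/m − log_q(q^l − 1)/log_q(q^m − 1) < 1/(4m(m − 1)). -/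
/-- The deficit `n - log_q (q ^ n - 1)` is positive, at most `4 / 2 ^ n`. -/
theorem logb_pow_sub_one_deficit_bounds {q : ℕ} (hq : 2 ≤ q) {n : ℕ} (hn : 1 ≤ n) :
    0 < (n : ℝ) - Real.logb q ((q : ℝ) ^ n - 1) ∧
      (n : ℝ) - Real.logb q ((q : ℝ) ^ n - 1) ≤ 4 / 2 ^ n := by
  have hq' : (2 : ℝ) ≤ q := by exact_mod_cast hq
  have hpow : (2 : ℝ) ^ n ≤ (q : ℝ) ^ n := by gcongr
  have htwo : (2 : ℝ) ≤ 2 ^ n := by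
    simpa using pow_le_pow_right₀ (one_le_two : (1 : ℝ) ≤ 2) hn
  have hlogq : 1 / 2 < Real.log q := by
    have := Real.log_le_log two_pos hq'
    linarith [Real.log_two_gt_d9]
  set y : ℝ := (q : ℝ) ^ n with hy
  have hy2 : 2 ≤ y := htwo.trans hpow
  have hdef : (n : ℝ) - Real.logb q (y - 1) = Real.log (y / (y - 1)) / Real.log q := by
    rw [Real.log_div (by linarith) (by linarith), Real.logb, hy, Real.log_pow]
    field_simp
  rw [hdef]
  constructor
  · apply div_pos (Real.log_pos _) (by linarith)
    rw [lt_div_iff₀ (by linarith)]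
    linarith
  · have h1 : Real.log (y / (y - 1)) ≤ y / (y - 1) - 1 :=
      Real.log_le_sub_one_of_pos (div_pos (by linarith) (by linarith))
    have h2 : y / (y - 1) - 1 ≤ 2 / y := by
      rw [div_sub_one (by linarith), div_le_div_iff₀ (by linarith) (by linarith)]
      linarith
    have h3 : 2 / y ≤ 2 / 2 ^ n := by gcongr
    have h4 : (0 : ℝ) < 4 / 2 ^ n := by positivity
    rw [div_le_iff₀ (by linarith)]
    have h5 : (2 : ℝ) / 2 ^ n = 4 / 2 ^ n * (1 / 2) := by ring
    nlinarith

/-- The deficit `n - log_q (q ^ n - 1)` decreases with `n`. -/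
theorem logb_pow_sub_one_deficit_le {q : ℕ} (hq : 2 ≤ q) {l m : ℕ} (hl : 1 ≤ l) (hlm : l ≤ m) :
    (m : ℝ) - Real.logb q ((q : ℝ) ^ m - 1) ≤ (l : ℝ) - Real.logb q ((q : ℝ) ^ l - 1) := by
  have hq' : (2 : ℝ) ≤ q := by exact_mod_cast hq
  have hlogq : 0 < Real.log q := Real.log_pos (by linarith)
  have hql : (2 : ℝ) ≤ (q : ℝ) ^ l := hq'.trans (le_self_pow₀ (by linarith) (by omega))
  obtain ⟨k, rfl⟩ := Nat.exists_eq_add_of_le hlm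
  have hqk : (1 : ℝ) ≤ (q : ℝ) ^ k := one_le_pow₀ (by linarith)
  have hk : Real.logb q ((q : ℝ) ^ k) = k := by
    rw [Real.logb, Real.log_pow]
    field_simp
  have hmul : Real.logb q ((q : ℝ) ^ k * ((q : ℝ) ^ l - 1)) =
      k + Real.logb q ((q : ℝ) ^ l - 1) := by
    rw [Real.logb_mul (by linarith) (by linarith), hk]
  have hle : Real.logb q ((q : ℝ) ^ k * ((q : ℝ) ^ l - 1)) ≤
      Real.logb q ((q : ℝ) ^ (l + k) - 1) := by
    apply Real.logb_le_logb_of_le (by linarith) (mul_pos (by linarith) (by linarith))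
    rw [pow_add]
    linarith
  push_cast
  linarith

theorem thirty_two_mul_lt_two_pow {l : ℕ} (hl : 9 ≤ l) : 32 * l < 2 ^ l := by
  induction l, hl using Nat.le_induction with
  | base => norm_num
  | succ n hn ih => rw [pow_succ]; omega


/-- Let `q ≥ 2` be an integer. There is a constant `l₀ > 0` (depending only on `q`)
such that for all integers `l, m` with `l₀ < l < m < 2l`:
`log_q(q^l − 1)/log_q(q^m − 1) < l/m` and
`l/m − log_q(q^l − 1)/log_q(q^m − 1) < 1/(4m(m − 1))`. -/
theorem stmt8 (q : ℕ) (hq : 2 ≤ q) :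
    ∃ l₀ : ℕ, 0 < l₀ ∧ ∀ l m : ℕ, l₀ < l → l < m → m < 2 * l →
      Real.logb q ((q : ℝ) ^ l - 1) / Real.logb q ((q : ℝ) ^ m - 1) < (l : ℝ) / m ∧
      (l : ℝ) / m - Real.logb q ((q : ℝ) ^ l - 1) / Real.logb q ((q : ℝ) ^ m - 1)
        < 1 / (4 * (m : ℝ) * ((m : ℝ) - 1)) := by
  refine ⟨8, by norm_num, fun l m hl hlm hml => ?_⟩
  obtain ⟨ha, ha'⟩ := logb_pow_sub_one_deficit_bounds hq (n := l) (by omega)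
  obtain ⟨hb, -⟩ := logb_pow_sub_one_deficit_bounds hq (n := m) (by omega)
  have hba := logb_pow_sub_one_deficit_le hq (l := l) (m := m) (by omega) hlm.le
  have hpow : 32 * (l : ℝ) < 2 ^ l := by exact_mod_cast thirty_two_mul_lt_two_pow hl
  have hl9 : (9 : ℝ) ≤ l := by exact_mod_cast hl
  have hlm' : (l : ℝ) < m := by exact_mod_cast hlm
  have hml' : (m : ℝ) < 2 * l := by exact_mod_cast hml
  generalize hA : (l : ℝ) - Real.logb q ((q : ℝ) ^ l - 1) = a at *
  generalize hB : (m : ℝ) - Real.logb q ((q : ℝ) ^ m - 1) = b at *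
  rw [show Real.logb q ((q : ℝ) ^ l - 1) = l - a by linarith,
    show Real.logb q ((q : ℝ) ^ m - 1) = m - b by linarith]
  have hla : 8 * l * a < 1 := by
    rw [le_div_iff₀ (by positivity)] at ha'
    nlinarith
  have hma : 4 * m * a < 1 := by nlinarith
  have hb1 : b < 1 := by nlinarith
  have hm : (0 : ℝ) < m := by linarith
  have hmb : 0 < m - b := by linarith
  constructor
  · rw [div_lt_div_iff₀ hmb hm]
    nlinarith
  · rw [div_sub_div _ _ hm.ne' hmb.ne', div_lt_div_iff₀ (mul_pos hm hmb)
      (mul_pos (by linarith) (by linarith))]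
    have hlb : 0 < l * b := mul_pos (by linarith) hb
    have hnum : 4 * (l * (m - b) - m * (l - a)) < 1 := by nlinarith
    have hm1 : 0 < m * ((m : ℝ) - 1) := mul_pos hm (by linarith)
    calc (l * (m - b) - m * (l - a)) * (4 * m * ((m : ℝ) - 1))
        = 4 * (l * (m - b) - m * (l - a)) * (m * ((m : ℝ) - 1)) := by ring
      _ < 1 * (m * ((m : ℝ) - 1)) := mul_lt_mul_of_pos_right hnum hm1
      _ ≤ 1 * (m * (m - b)) := by gcongr
end
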